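/- Let A be a k-algebra whose center Z is an integral domain with nonzero Jacobson radical. Then Z is strongly retractable, and consequently A is strongly cancellative and strongly Morita cancellative. -/

import Mathlib

open scoped TensorProduct

universe u

/-- The polynomial extension `A[t₁,…,tₙ]` of a (possibly noncommutative) `k`-algebra `A`
in `n` central, mutually commuting indeterminates. -/
abbrev PolyExt (A : Type u) [Ring A] (n : ℕ) : Type u :=
  AddMonoidAlgebra A (Fin n →₀ ℕ)

/-- The canonical embedding `A → A[t₁,…,tₙ]` as constant polynomials. -/
noncomputable def PolyExt.C (k A : Type u) [Field k] [Ring A] [Algebra k A] (n : ℕ) :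
    A →ₐ[k] PolyExt A n :=
  AddMonoidAlgebra.singleZeroAlgHom

/-- The `i`-th indeterminate of `A[t₁,…,tₙ]`. -/
noncomputable def PolyExt.X (A : Type u) [Ring A] (n : ℕ) (i : Fin n) : PolyExt A n :=
  AddMonoidAlgebra.single (Finsupp.single i 1) 1

/-- Two rings are Morita equivalent if their categories of right modules are
equivalent (as abelian categories). -/
def MoritaEquivalent (R S : Type u) [Ring R] [Ring S] : Prop :=
  Nonempty (ModuleCat.{u} Rᵐᵒᵖ ≌ ModuleCat.{u} Sᵐᵒᵖ)

/-- `A` is strongly cancellative: for every `n ≥ 1` and every `k`-algebra `B`, any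
`k`-algebra isomorphism `A[s₁,…,sₙ] ≅ B[t₁,…,tₙ]` implies `A ≅ B`. -/
def StronglyCancellative (k A : Type u) [Field k] [Ring A] [Algebra k A] : Prop :=
  ∀ (n : ℕ), 1 ≤ n → ∀ (B : Type u) [Ring B] [Algebra k B],
    Nonempty (PolyExt A n ≃ₐ[k] PolyExt B n) → Nonempty (A ≃ₐ[k] B)

/-- `A` is strongly Morita cancellative: for every `n ≥ 1` and every `k`-algebra `B`,
Morita equivalence of `A[s₁,…,sₙ]` and `B[t₁,…,tₙ]` implies Morita equivalence of `A` and `B`. -/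
def StronglyMoritaCancellative (k A : Type u) [Field k] [Ring A] [Algebra k A] : Prop :=
  ∀ (n : ℕ), 1 ≤ n → ∀ (B : Type u) [Ring B] [Algebra k B],
    MoritaEquivalent (PolyExt A n) (PolyExt B n) → MoritaEquivalent A B

/-- `A` is strongly retractable: every `k`-algebra isomorphism
`φ : A[s₁,…,sₙ] → B[t₁,…,tₙ]` (with `n ≥ 1`) satisfies `φ(A) = B`. -/
def StronglyRetractable (k A : Type u) [Field k] [Ring A] [Algebra k A] : Prop :=
  ∀ (n : ℕ), 1 ≤ n → ∀ (B : Type u) [Ring B] [Algebra k B]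
    (φ : PolyExt A n ≃ₐ[k] PolyExt B n),
    φ '' Set.range (PolyExt.C k A n) = Set.range (PolyExt.C k B n)

/-- `A` is strongly detectable: for every `k`-algebra isomorphism
`φ : A[s₁,…,sₙ] → B[t₁,…,tₙ]` (with `n ≥ 1`), the subalgebra of `B[t₁,…,tₙ]` generated by
`B` together with `φ(s₁),…,φ(sₙ)` is all of `B[t₁,…,tₙ]`. -/
def StronglyDetectable (k A : Type u) [Field k] [Ring A] [Algebra k A] : Prop :=
  ∀ (n : ℕ), 1 ≤ n → ∀ (B : Type u) [Ring B] [Algebra k B]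
    (φ : PolyExt A n ≃ₐ[k] PolyExt B n),
    Algebra.adjoin k
      (Set.range (PolyExt.C k B n) ∪ Set.range fun i => φ (PolyExt.X A n i)) = ⊤

theorem MvPolynomial.eq_C_of_C_mul_eq_C {σ R : Type*} [CommRing R] [IsDomain R] {a b : R}
    (ha : a ≠ 0) {p : MvPolynomial σ R} (h : C a * p = C b) : p = C (p.coeff 0) := by
  classical
  ext m
  rw [coeff_C]
  split_ifs with hm
  · rw [← hm]
  · have := congrArg (MvPolynomial.coeff m) h
    rw [coeff_C_mul, coeff_C, if_neg hm] at this
    exact (mul_eq_zero.1 this).resolve_left ha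

theorem MvPolynomial.eq_C_of_dvd_C {σ R : Type*} [CommRing R] [IsDomain R] {a : R}
    (ha : a ≠ 0) {p : MvPolynomial σ R} (h : p ∣ C a) : p = C (p.coeff 0) := by
  obtain ⟨q, hq⟩ := h
  have hC : (C a : MvPolynomial σ R) ≠ 0 := by simpa using ha
  have hpq : p * q ≠ 0 := hq ▸ hC
  have := congrArg totalDegree hq
  rw [totalDegree_C, totalDegree_mul_of_isDomain (left_ne_zero_of_mul hpq)
    (right_ne_zero_of_mul hpq)] at this
  exact totalDegree_eq_zero_iff_eq_C.1 (by omega)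

/-- A ring isomorphism between polynomial rings in finitely many variables sends constants to
constants if the source has coefficients in a domain with nonzero Jacobson radical. -/
theorem MvPolynomial.map_C_eq_C_of_jacobson_ne_bot {σ τ Z W : Type*} [CommRing Z] [CommRing W]
    [IsDomain Z] (hJ : Ideal.jacobson (⊥ : Ideal Z) ≠ ⊥)
    (ψ : MvPolynomial σ Z ≃+* MvPolynomial τ W) (z : Z) : ∃ w, ψ (C z) = C w := by
  have : IsDomain (MvPolynomial τ W) := ψ.symm.injective.isDomain ψ.symm.toRingHom
  have : IsDomain W := (C_injective τ W).isDomain (C : W →+* _)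
  obtain ⟨r, hr, hr0⟩ := Submodule.exists_mem_ne_zero_of_ne_bot hJ
  have key (y : Z) : ∃ w, ψ (C (r * y)) = C w := by
    have h1 : IsUnit (ψ (C (r * y + 1))) :=
      ((Ideal.mem_jacobson_bot.1 hr y).map C).map ψ
    obtain ⟨w, -, hw⟩ := isUnit_iff_eq_C_of_isReduced.1 h1
    exact ⟨w - 1, by rw [C_sub, ← hw]; simp⟩
  obtain ⟨a, ha⟩ := key 1
  obtain ⟨b, hb⟩ := key z
  rw [mul_one] at ha
  refine ⟨_, eq_C_of_C_mul_eq_C (a := a) (b := b) ?_ ?_⟩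
  · rintro rfl
    exact hr0 (C_injective σ Z (ψ.injective (by simpa using ha)))
  · rw [← ha, ← hb, ← map_mul, C_mul]

/-- A ring isomorphism `Z[s₁,…,sₙ] ≃ W[t₁,…,tₙ]` restricts to an isomorphism `Z ≃ W` if `Z` is a
domain with nonzero Jacobson radical. -/
theorem MvPolynomial.exists_ringEquiv_of_jacobson_ne_bot {n : ℕ} {Z W : Type u} [CommRing Z]
    [CommRing W] [IsDomain Z] (hJ : Ideal.jacobson (⊥ : Ideal Z) ≠ ⊥)
    (ψ : MvPolynomial (Fin n) Z ≃+* MvPolynomial (Fin n) W) :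
    ∃ θ : Z ≃+* W, ∀ z, ψ (C z) = C (θ z) := by
  have : IsDomain (MvPolynomial (Fin n) W) := ψ.symm.injective.isDomain ψ.symm.toRingHom
  have : IsDomain W := (C_injective (Fin n) W).isDomain (C : W →+* _)
  let θ : Z →+* W := constantCoeff.comp (ψ.toRingHom.comp C)
  have hθ (z : Z) : ψ (C z) = C (θ z) := by
    obtain ⟨w, hw⟩ := map_C_eq_C_of_jacobson_ne_bot hJ ψ z
    have : θ z = w := by simp [θ, hw]
    rw [this, hw]
  have hinj : Function.Injective θ := fun x y h =>
    C_injective (Fin n) Z (ψ.injective (by rw [hθ, hθ, h]))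
  let _ : Algebra Z W := θ.toAlgebra
  have : FaithfulSMul Z W := (faithfulSMul_iff_algebraMap_injective Z W).2 hinj
  let e : MvPolynomial (Fin n) Z ≃ₐ[Z] MvPolynomial (Fin n) W :=
    AlgEquiv.ofRingEquiv (f := ψ) hθ
  have h := trdeg_add_eq Z W (A := MvPolynomial (Fin n) W)
  rw [← e.trdeg_eq, MvPolynomial.trdeg_of_isDomain, MvPolynomial.trdeg_of_isDomain] at h
  have h0 : Algebra.trdeg Z W = 0 := by
    have : Algebra.trdeg Z W + (n : Cardinal) = 0 + n := by simpa using h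
    exact Cardinal.eq_of_add_eq_add_right this (Cardinal.natCast_lt_aleph0)
  have halg : Algebra.IsAlgebraic Z W := trdeg_eq_zero_iff.1 h0
  refine ⟨RingEquiv.ofBijective θ ⟨hinj, fun w => ?_⟩, hθ⟩
  by_cases hw : w = 0
  · exact ⟨0, by simp [hw]⟩
  obtain ⟨z, hz, hdvd⟩ := (halg.isAlgebraic w).exists_nonzero_dvd
    (mem_nonZeroDivisors_of_ne_zero hw)
  have h1 : ψ.symm (C w) ∣ C z := by
    rw [← map_dvd_iff ψ, RingEquiv.apply_symm_apply, hθ]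
    exact map_dvd C hdvd
  have h2 := eq_C_of_dvd_C hz h1
  refine ⟨coeff 0 (ψ.symm (C w)), C_injective (Fin n) W ?_⟩
  rw [← hθ, ← h2, RingEquiv.apply_symm_apply]

namespace PolyExt

variable {A Z : Type u} [Ring A] [CommRing Z] (ι : Z →+* A) {n : ℕ}

theorem mapRingHom_injective (hinj : Function.Injective ι) :
    Function.Injective (AddMonoidAlgebra.mapRingHom (Fin n →₀ ℕ) ι) :=
  AddMonoidAlgebra.map_injective (ι : Z →+ A) hinj

/-- The center of `A[t₁,…,tₙ]` consists of the polynomials with coefficients in the center of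
`A`. -/
theorem range_mapRingHom_eq_center (hι : Set.range ι = Set.center A) :
    Set.range (AddMonoidAlgebra.mapRingHom (Fin n →₀ ℕ) ι) = Set.center (PolyExt A n) := by
  ext f
  constructor
  · rintro ⟨g, rfl⟩
    rw [Semigroup.mem_center_iff]
    intro f
    induction g using AddMonoidAlgebra.induction_linear with
    | zero => simp
    | add g₁ g₂ h₁ h₂ => rw [map_add, mul_add, add_mul, h₁, h₂]
    | single _ z =>
      have hz : ι z ∈ Set.center A := hι ▸ Set.mem_range_self z
      induction f using AddMonoidAlgebra.induction_linear with
      | zero => simp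
      | add f₁ f₂ h₁ h₂ => rw [mul_add, add_mul, h₁, h₂]
      | single m' a =>
        rw [AddMonoidAlgebra.mapRingHom_single, AddMonoidAlgebra.single_mul_single,
          AddMonoidAlgebra.single_mul_single, add_comm, Semigroup.mem_center_iff.1 hz a]
  · intro hf
    have hcoeff (m) : f.coeff m ∈ Set.range ι := by
      rw [hι, Semigroup.mem_center_iff]
      intro a
      have := congrArg (fun g => g.coeff m)
        (Semigroup.mem_center_iff.1 hf (AddMonoidAlgebra.single 0 a))
      simpa [AddMonoidAlgebra.coeff_single_zero_mul, AddMonoidAlgebra.coeff_mul_single_zero]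
        using this
    change f ∈ (AddMonoidAlgebra.mapRingHom (Fin n →₀ ℕ) ι).range
    rw [← f.sum_coeff_single]
    refine sum_mem fun m _ => ?_
    obtain ⟨z, hz⟩ := hcoeff m
    exact ⟨AddMonoidAlgebra.single m z, by rw [AddMonoidAlgebra.mapRingHom_single, hz]⟩

variable (hι : Set.range ι = Set.center A) (c : Fin n → Z)

/-- Evaluation of the indeterminates of `A[t₁,…,tₙ]` at central elements of `A`. -/
noncomputable def evalCenter : PolyExt A n →+* A :=
  AddMonoidAlgebra.liftNCRingHom (RingHom.id A)
    (((ι.comp (MvPolynomial.eval c) : MvPolynomial (Fin n) Z →+* A) :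
      MvPolynomial (Fin n) Z →* A).comp (AddMonoidAlgebra.of Z (Fin n →₀ ℕ)))
    fun a _ => Semigroup.mem_center_iff.1 (hι ▸ Set.mem_range_self _) a

theorem evalCenter_single (m : Fin n →₀ ℕ) (a : A) :
    evalCenter ι hι c (AddMonoidAlgebra.single m a) =
      a * ι (MvPolynomial.eval c (MvPolynomial.monomial m 1)) :=
  AddMonoidAlgebra.liftNCRingHom_single _ _ _ _ _

@[simp]
theorem evalCenter_single_zero (a : A) :
    evalCenter ι hι c (AddMonoidAlgebra.single 0 a) = a := by
  rw [evalCenter_single, MvPolynomial.eval_monomial]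
  simp

theorem evalCenter_mapRingHom (g : MvPolynomial (Fin n) Z) :
    evalCenter ι hι c (AddMonoidAlgebra.mapRingHom (Fin n →₀ ℕ) ι g) =
      ι (MvPolynomial.eval c g) := by
  induction g using AddMonoidAlgebra.induction_linear with
  | zero => simp
  | add g₁ g₂ h₁ h₂ => rw [map_add, map_add, h₁, h₂, map_add, map_add]
  | single m z =>
    rw [AddMonoidAlgebra.mapRingHom_single, evalCenter_single, ← map_mul]
    change _ = ι (MvPolynomial.eval c (MvPolynomial.monomial m z))
    rw [MvPolynomial.eval_monomial, MvPolynomial.eval_monomial, one_mul]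

theorem sub_evalCenter_mem_span (f : PolyExt A n) :
    f - AddMonoidAlgebra.single 0 (evalCenter ι hι c f) ∈
      Ideal.span (AddMonoidAlgebra.mapRingHom (Fin n →₀ ℕ) ι ''
        {g : MvPolynomial (Fin n) Z | MvPolynomial.eval c g = 0}) := by
  induction f using AddMonoidAlgebra.induction_linear with
  | zero => simp
  | add f₁ f₂ h₁ h₂ =>
    rw [map_add, AddMonoidAlgebra.single_add, add_sub_add_comm]
    exact add_mem h₁ h₂
  | single m a =>
    have : (AddMonoidAlgebra.single m a - AddMonoidAlgebra.single 0
        (evalCenter ι hι c (AddMonoidAlgebra.single m a)) : PolyExt A n) =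
        AddMonoidAlgebra.single 0 a * AddMonoidAlgebra.mapRingHom (Fin n →₀ ℕ) ι
          (MvPolynomial.monomial m 1 -
            MvPolynomial.C (MvPolynomial.eval c (MvPolynomial.monomial m 1))) := by
      rw [evalCenter_single, map_sub, mul_sub]
      generalize MvPolynomial.eval c (MvPolynomial.monomial m 1) = z
      rw [← MvPolynomial.single_eq_monomial]
      change _ = _ - _ * AddMonoidAlgebra.mapRingHom _ ι (AddMonoidAlgebra.single 0 z)
      simp [AddMonoidAlgebra.single_mul_single]
    rw [this]
    exact Ideal.mul_mem_left _ _ (Ideal.subset_span ⟨_, by simp, rfl⟩)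

theorem mem_of_evalCenter_eq_zero {I : Ideal (PolyExt A n)}
    (hI : ∀ g, MvPolynomial.eval c g = 0 → AddMonoidAlgebra.mapRingHom (Fin n →₀ ℕ) ι g ∈ I)
    {f : PolyExt A n} (hf : evalCenter ι hι c f = 0) : f ∈ I := by
  have := sub_evalCenter_mem_span ι hι c f
  rw [hf, AddMonoidAlgebra.single_zero, sub_zero] at this
  refine Ideal.span_le.2 ?_ this
  rintro _ ⟨g, hg, rfl⟩
  exact hI g hg

end PolyExt

/-- If `ψ : Z[s₁,…,sₙ] ≃ W[t₁,…,tₙ]` maps constants to constants, then it maps the ideal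
`(s₁,…,sₙ)` to the kernel of an evaluation homomorphism. -/
theorem MvPolynomial.exists_eval_eq_zero_iff {σ τ Z W : Type*} [CommRing Z] [CommRing W]
    (ψ : MvPolynomial σ Z ≃+* MvPolynomial τ W) (θ : Z ≃+* W) (h : ∀ z, ψ (C z) = C (θ z)) :
    ∃ c : τ → W, ∀ g, eval c (ψ g) = 0 ↔ eval (0 : σ → Z) g = 0 := by
  let c (i : τ) : W := θ (eval 0 (ψ.symm (X i)))
  have key : (eval c : MvPolynomial τ W →+* W) =
      θ.toRingHom.comp ((eval (0 : σ → Z)).comp ψ.symm.toRingHom) := by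
    refine ringHom_ext (fun w => ?_) fun i => by simp [c]
    have : ψ.symm (C w) = C (θ.symm w) := by
      rw [RingEquiv.symm_apply_eq, h, RingEquiv.apply_symm_apply]
    simp [this]
  refine ⟨c, fun g => ?_⟩
  rw [key]
  simp

/-- A ring isomorphism induces an isomorphism of centers, here given as injective ring
homomorphisms from commutative rings. -/
theorem RingEquiv.exists_center_ringEquiv {R S P Q : Type*} [Ring R] [Ring S] [CommRing P]
    [CommRing Q] (e : R ≃+* S) {j : P →+* R} {l : Q →+* S} (hj : Function.Injective j)
    (hl : Function.Injective l) (hjc : Set.range j = Set.center R)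
    (hlc : Set.range l = Set.center S) : ∃ ψ : P ≃+* Q, ∀ p, l (ψ p) = e (j p) := by
  have hrange (s : S) : s ∈ l.range ↔ s ∈ ((e : R →+* S).comp j).range := by
    change s ∈ Set.range l ↔ s ∈ Set.range (e ∘ j)
    rw [hlc, Set.range_comp, hjc]
    constructor
    · intro hs
      refine ⟨e.symm s, Semigroup.mem_center_iff.2 fun r => e.injective ?_, by simp⟩
      simpa using Semigroup.mem_center_iff.1 hs (e r)
    · rintro ⟨r, hr, rfl⟩
      refine Semigroup.mem_center_iff.2 fun s => e.symm.injective ?_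
      simpa using Semigroup.mem_center_iff.1 hr (e.symm s)
  let a : P ≃+* ((e : R →+* S).comp j).range :=
    RingEquiv.ofBijective ((e : R →+* S).comp j).rangeRestrict
      ⟨fun x y hxy => hj (e.injective (congrArg Subtype.val hxy)),
        RingHom.rangeRestrict_surjective _⟩
  let b : Q ≃+* l.range := RingEquiv.ofBijective l.rangeRestrict
      ⟨fun x y hxy => hl (congrArg Subtype.val hxy), RingHom.rangeRestrict_surjective _⟩
  refine ⟨a.trans ((RingEquiv.subringCongr (Subring.ext hrange).symm).trans b.symm), fun p => ?_⟩
  change (b (b.symm _)).1 = _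
  rw [RingEquiv.apply_symm_apply]
  rfl

open CategoryTheory

namespace ModuleCat

/-- A homomorphism `j` from a commutative ring to the center of `R` induces a homomorphism to the
center of the category of `R`-modules. -/
noncomputable def toCatCenter {P R : Type u} [CommRing P] [Ring R] (j : P →+* R)
    (hj : Set.range j = Set.center R) : P →+* CatCenter (ModuleCat.{u} R) where
  toFun p :=
    { app := fun M => ofHom
        { toFun := fun m => j p • m
          map_add' := smul_add _
          map_smul' := fun r m => by
            simp only [RingHom.id_apply, ← mul_smul]
            rw [Semigroup.mem_center_iff.1 (hj ▸ Set.mem_range_self p) r] }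
      naturality := fun M N f => by ext m; simp }
  map_one' := by ext M m; change j 1 • m = m; simp
  map_zero' := by ext M m; change j 0 • m = 0; simp
  map_mul' p q := by ext M m; change j (p * q) • m = j p • j q • m; rw [map_mul, mul_smul]
  map_add' p q := by ext M m; change j (p + q) • m = j p • m + j q • m; rw [map_add, add_smul]

theorem toCatCenter_bijective {P R : Type u} [CommRing P] [Ring R] (j : P →+* R)
    (hj : Set.range j = Set.center R) (hinj : Function.Injective j) :
    Function.Bijective (toCatCenter j hj) := by
  constructor
  · intro p q h
    have := congrArg (fun c : CatCenter (ModuleCat.{u} R) => c.app (of R R) (1 : R)) h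
    change j p • (1 : R) = j q • (1 : R) at this
    exact hinj (by simpa using this)
  · intro c
    have key (M : ModuleCat.{u} R) (m : M) : c.app M m = (c.app (of R R) (1 : R) : R) • m := by
      have := congrArg (fun f => f (1 : R)) (c.naturality (ofHom (LinearMap.toSpanSingleton R M m)))
      simpa using this
    have hc : (c.app (of R R) (1 : R) : R) ∈ Set.range j := by
      rw [hj, Semigroup.mem_center_iff]
      intro r
      have h1 := key (of R R) r
      have h2 := (c.app (of R R)).hom.map_smul r (1 : R)
      rw [smul_eq_mul] at h1 h2
      rw [smul_eq_mul, mul_one] at h2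
      exact h2.symm.trans h1
    obtain ⟨p, hp⟩ := hc
    refine ⟨p, ?_⟩
    ext M m
    change j p • m = c.app M m
    rw [hp]
    exact (key M m).symm

end ModuleCat

/-- An equivalence of module categories induces an isomorphism of the centers of the rings, here
given as injective ring homomorphisms from commutative rings. -/
theorem CategoryTheory.Equivalence.exists_center_ringEquiv {P Q R S : Type u} [CommRing P]
    [CommRing Q] [Ring R] [Ring S] (E : ModuleCat.{u} R ≌ ModuleCat.{u} S) {j : P →+* R}
    {l : Q →+* S} (hj : Function.Injective j) (hl : Function.Injective l)
    (hjc : Set.range j = Set.center R) (hlc : Set.range l = Set.center S) :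
    ∃ ψ : P ≃+* Q, ∀ (p : P) (N : ModuleCat.{u} S),
      (∀ x : N, l (ψ p) • x = 0) ↔ ∀ x : E.inverse.obj N, j p • x = 0 := by
  have : E.inverse.Additive := Functor.additive_of_preserves_binary_products E.inverse
  let W := MorphismProperty.isomorphisms (ModuleCat.{u} S)
  have : E.inverse.IsLocalization W :=
    Functor.IsLocalization.of_isEquivalence _ _ le_rfl
  let L := CatCenter.localizationRingHom E.inverse W
  have hL (c : CatCenter (ModuleCat.{u} S)) (X) :
      (L c).app (E.inverse.obj X) = E.inverse.map (c.app X) := CatCenter.localization_app ..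
  have hLbij : Function.Bijective L := by
    constructor
    · intro c d h
      ext1 X
      apply E.inverse.map_injective
      rw [← hL, ← hL, h]
    · intro d
      refine ⟨{ app := fun X => E.inverse.preimage (d.app (E.inverse.obj X))
                naturality := fun X Y f => E.inverse.map_injective ?_ }, ?_⟩
      · simpa using d.naturality (E.inverse.map f)
      · refine CatCenter.ext_of_localization E.inverse W _ _ fun X => ?_
        rw [hL]
        simp [CatCenter.app]
  let a := RingEquiv.ofBijective _ (ModuleCat.toCatCenter_bijective j hjc hj)
  let b := RingEquiv.ofBijective _ (ModuleCat.toCatCenter_bijective l hlc hl)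
  let L' := RingEquiv.ofBijective L hLbij
  refine ⟨a.trans (L'.symm.trans b.symm), fun p N => ?_⟩
  have h : L (ModuleCat.toCatCenter l hlc (a.trans (L'.symm.trans b.symm) p)) =
      ModuleCat.toCatCenter j hjc p := by
    change L' (b (b.symm (L'.symm (a p)))) = a p
    simp
  have h1 := hL (ModuleCat.toCatCenter l hlc (a.trans (L'.symm.trans b.symm) p)) N
  rw [h] at h1
  generalize a.trans (L'.symm.trans b.symm) p = q at h1
  have hl0 : (∀ x : N, l q • x = 0) ↔ (ModuleCat.toCatCenter l hlc q).app N = 0 :=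
    ⟨fun h => by ext x; exact h x, fun h x => congrArg (fun f => f x) h⟩
  have hj0 : (∀ x : E.inverse.obj N, j p • x = 0) ↔
      (ModuleCat.toCatCenter j hjc p).app (E.inverse.obj N) = 0 :=
    ⟨fun h => by ext x; exact h x, fun h x => congrArg (fun f => f x) h⟩
  rw [hl0, hj0, h1, Functor.map_eq_zero_iff]

/-- Fully faithful functors with the same essential image have equivalent sources. -/
theorem CategoryTheory.Functor.nonempty_equivalence_of_essImage_eq {C C' D : Type*} [Category* C]
    [Category* C'] [Category* D] (F : C ⥤ D) (G : C' ⥤ D) [F.Full] [F.Faithful] [G.Full]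
    [G.Faithful] (h : F.essImage = G.essImage) : Nonempty (C ≌ C') := by
  have hG : Nonempty (C' ≌ F.EssImageSubcategory) := by
    unfold Functor.EssImageSubcategory
    rw [h]
    exact ⟨G.toEssImage.asEquivalence⟩
  exact hG.map fun e => F.toEssImage.asEquivalence.trans e.symm

namespace ModuleCat

variable {R S : Type u} [Ring R] [Ring S] {f : R →+* S}

theorem restrictScalars_full_of_surjective (hf : Function.Surjective f) :
    (restrictScalars.{u} f).Full where
  map_surjective {M N} g := by
    refine ⟨ofHom { toFun := g.hom, map_add' := g.hom.map_add, map_smul' := fun s m => ?_ }, rfl⟩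
    obtain ⟨r, rfl⟩ := hf s
    exact g.hom.map_smul r m

/-- The essential image of restriction of scalars along a surjective homomorphism `f` consists of
the modules annihilated by the kernel of `f`. -/
theorem restrictScalars_essImage_iff (hf : Function.Surjective f) (M : ModuleCat.{u} R) :
    (restrictScalars.{u} f).essImage M ↔ ∀ r, f r = 0 → ∀ m : M, r • m = 0 := by
  constructor
  · rintro ⟨N, ⟨e⟩⟩ r hr m
    obtain ⟨m, rfl⟩ := e.toLinearEquiv.surjective m
    rw [← map_smul]
    change e.toLinearEquiv (f r • (show N from m)) = 0
    rw [hr, zero_smul]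
    exact map_zero _
  · intro h
    let g : S →+* AddMonoid.End M := f.liftOfSurjective hf ⟨Module.toAddMonoidEnd R M,
      fun r hr => by ext m; exact h r hr m⟩
    have hg (r : R) (m : M) : g (f r) m = r • m := by
      have : g.comp f = Module.toAddMonoidEnd R M := f.liftOfRightInverse_comp _ _ _
      exact congrArg (fun k : R →+* AddMonoid.End M => k r m) this
    let _ : Module S M := Module.compHom M g
    let e : (restrictScalars f).obj (of S M) ≃ₗ[R] M :=
      { AddEquiv.refl M with map_smul' := hg }
    exact ⟨of S M, ⟨e.toModuleIso⟩⟩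

end ModuleCat

/-- A criterion for an equivalence of module categories to induce an equivalence between the
module categories of quotient rings. -/
theorem ModuleCat.nonempty_equivalence_of_surjective {R S R' S' : Type u} [Ring R] [Ring S]
    [Ring R'] [Ring S'] (E : ModuleCat.{u} R ≌ ModuleCat.{u} S) {f : R →+* R'} {g : S →+* S'}
    (hf : Function.Surjective f) (hg : Function.Surjective g)
    (h : ∀ N : ModuleCat.{u} S, (∀ s, g s = 0 → ∀ x : N, s • x = 0) ↔
      ∀ r, f r = 0 → ∀ x : E.inverse.obj N, r • x = 0) :
    Nonempty (ModuleCat.{u} R' ≌ ModuleCat.{u} S') := by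
  have := restrictScalars_full_of_surjective hf
  have := restrictScalars_full_of_surjective hg
  refine Functor.nonempty_equivalence_of_essImage_eq
    (restrictScalars f ⋙ E.functor) (restrictScalars g) ?_
  ext N
  rw [restrictScalars_essImage_iff hg, h, ← restrictScalars_essImage_iff hf]
  constructor
  · rintro ⟨M, ⟨e⟩⟩
    exact ⟨M, ⟨E.unitIso.app _ ≪≫ E.inverse.mapIso e⟩⟩
  · rintro ⟨M, ⟨e⟩⟩
    exact ⟨M, ⟨E.functor.mapIso e ≪≫ E.counitIso.app _⟩⟩

namespace PolyExt

variable {k A B Z W : Type u} [Field k] [Ring A] [Ring B] [Algebra k A] [Algebra k B]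
  [CommRing Z] [CommRing W] {n : ℕ} (ι : Z →+* A) (κ : W →+* B)

/-- Cancellation for algebras whose center is a domain with nonzero Jacobson radical. -/
theorem nonempty_algEquiv [IsDomain Z] (hJ : Ideal.jacobson (⊥ : Ideal Z) ≠ ⊥)
    (hι : Function.Injective ι)
    (hκ : Function.Injective κ) (hιc : Set.range ι = Set.center A)
    (hκc : Set.range κ = Set.center B) (φ : PolyExt A n ≃ₐ[k] PolyExt B n) :
    Nonempty (A ≃ₐ[k] B) := by
  obtain ⟨ψ, hψ⟩ := (φ : PolyExt A n ≃+* PolyExt B n).exists_center_ringEquiv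
    (mapRingHom_injective ι hι) (mapRingHom_injective κ hκ)
    (range_mapRingHom_eq_center ι hιc) (range_mapRingHom_eq_center κ hκc)
  obtain ⟨θ, hθ⟩ := MvPolynomial.exists_ringEquiv_of_jacobson_ne_bot hJ ψ
  obtain ⟨c, hc⟩ := MvPolynomial.exists_eval_eq_zero_iff ψ θ hθ
  have h1 (f) (hf : evalCenter ι hιc 0 f = 0) : evalCenter κ hκc c (φ f) = 0 := by
    refine mem_of_evalCenter_eq_zero ι hιc 0
      (I := RingHom.ker ((evalCenter κ hκc c).comp (φ : PolyExt A n →+* PolyExt B n)))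
      (fun g hg => ?_) hf
    change evalCenter κ hκc c (φ _) = 0
    have := hψ g
    change _ = φ _ at this
    rw [← this, evalCenter_mapRingHom, (hc g).2 hg, map_zero]
  have h2 (f) (hf : evalCenter κ hκc c f = 0) : evalCenter ι hιc 0 (φ.symm f) = 0 := by
    refine mem_of_evalCenter_eq_zero κ hκc c
      (I := RingHom.ker ((evalCenter ι hιc 0).comp (φ.symm : PolyExt B n →+* PolyExt A n)))
      (fun g hg => ?_) hf
    change evalCenter ι hιc 0 (φ.symm _) = 0
    obtain ⟨g, rfl⟩ := ψ.surjective g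
    rw [hψ]
    change evalCenter ι hιc 0 (φ.symm (φ _)) = 0
    rw [φ.symm_apply_apply, evalCenter_mapRingHom, (hc g).1 hg, map_zero]
  let F : A →ₐ[k] B :=
    { (evalCenter κ hκc c).comp ((φ.toAlgHom.comp (PolyExt.C k A n) : A →ₐ[k] PolyExt B n) :
        A →+* PolyExt B n) with
      commutes' := fun r => by
        change evalCenter κ hκc c ((φ.toAlgHom.comp (PolyExt.C k A n)) (algebraMap k A r)) = _
        rw [AlgHom.commutes, ← (PolyExt.C k B n).commutes]
        exact evalCenter_single_zero κ hκc c _ }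
  have hF (a : A) : F a = evalCenter κ hκc c (φ (AddMonoidAlgebra.single 0 a)) := rfl
  refine ⟨AlgEquiv.ofBijective F ⟨(injective_iff_map_eq_zero F).2 fun a ha => ?_, fun b => ?_⟩⟩
  · have := h2 _ ((hF a).symm.trans ha)
    rwa [φ.symm_apply_apply, evalCenter_single_zero] at this
  · let f := φ.symm (AddMonoidAlgebra.single 0 b)
    refine ⟨evalCenter ι hιc 0 f, ?_⟩
    have := h1 (f - AddMonoidAlgebra.single 0 (evalCenter ι hιc 0 f)) (by simp)
    rw [map_sub, map_sub, sub_eq_zero] at this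
    rw [hF, ← this, φ.apply_symm_apply, evalCenter_single_zero]

theorem op_smul_eq_zero {M : Type*} [AddCommGroup M] [Module (PolyExt A n)ᵐᵒᵖ M]
    (hιc : Set.range ι = Set.center A) (c : Fin n → Z)
    (hM : ∀ g, MvPolynomial.eval c g = 0 →
      ∀ m : M, MulOpposite.op (AddMonoidAlgebra.mapRingHom (Fin n →₀ ℕ) ι g) • m = 0)
    {f : PolyExt A n} (hf : evalCenter ι hιc c f = 0) (m : M) : MulOpposite.op f • m = 0 := by
  let I : Ideal (PolyExt A n) :=
    { carrier := {f | ∀ m : M, MulOpposite.op f • m = 0}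
      add_mem' := fun {a b} ha hb m => by
        rw [MulOpposite.op_add, add_smul, ha, hb, add_zero]
      zero_mem' := fun m => by rw [MulOpposite.op_zero, zero_smul]
      smul_mem' := fun a f hf m => by
        rw [smul_eq_mul, MulOpposite.op_mul, mul_smul, hf] }
  exact mem_of_evalCenter_eq_zero (I := I) ι hιc c hM hf m

end PolyExt

theorem MulOpposite.range_toOpposite_eq_center {P R : Type*} [CommRing P] [Ring R] (j : P →+* R)
    (hj : Set.range j = Set.center R) :
    Set.range (j.toOpposite fun _ _ => ((Commute.all _ _).map j)) = Set.center Rᵐᵒᵖ := by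
  ext r
  induction r using MulOpposite.rec' with
  | h r =>
    have : MulOpposite.op r ∈ Set.center Rᵐᵒᵖ ↔ r ∈ Set.center R := by
      simp only [Semigroup.mem_center_iff]
      refine ⟨fun h s => ?_, fun h s => ?_⟩
      · exact MulOpposite.op_injective (h (op s)).symm
      · exact MulOpposite.unop_injective (h (unop s)).symm
    rw [this, ← hj]
    exact ⟨fun ⟨p, hp⟩ => ⟨p, MulOpposite.op_injective hp⟩, fun ⟨p, hp⟩ => ⟨p, congrArg op hp⟩⟩

namespace PolyExt

variable {A B Z W : Type u} [Ring A] [Ring B]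
  [CommRing Z] [CommRing W] {n : ℕ} (ι : Z →+* A) (κ : W →+* B)

/-- Morita cancellation for rings whose center is a domain with nonzero Jacobson radical. -/
theorem moritaEquivalent [IsDomain Z] (hJ : Ideal.jacobson (⊥ : Ideal Z) ≠ ⊥)
    (hι : Function.Injective ι)
    (hκ : Function.Injective κ) (hιc : Set.range ι = Set.center A)
    (hκc : Set.range κ = Set.center B) (h : MoritaEquivalent (PolyExt A n) (PolyExt B n)) :
    MoritaEquivalent A B := by
  obtain ⟨E⟩ := h
  obtain ⟨ψ, hψ⟩ := E.exists_center_ringEquiv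
    (j := RingHom.toOpposite _ fun _ _ => (Commute.all _ _).map _)
    (l := RingHom.toOpposite _ fun _ _ => (Commute.all _ _).map _)
    (MulOpposite.op_injective.comp (mapRingHom_injective (n := n) ι hι))
    (MulOpposite.op_injective.comp (mapRingHom_injective (n := n) κ hκ))
    (MulOpposite.range_toOpposite_eq_center _ (range_mapRingHom_eq_center ι hιc))
    (MulOpposite.range_toOpposite_eq_center _ (range_mapRingHom_eq_center κ hκc))
  obtain ⟨θ, hθ⟩ := MvPolynomial.exists_ringEquiv_of_jacobson_ne_bot hJ ψ
  obtain ⟨c, hc⟩ := MvPolynomial.exists_eval_eq_zero_iff ψ θ hθ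
  refine ModuleCat.nonempty_equivalence_of_surjective E
    (f := (evalCenter ι hιc 0).op) (g := (evalCenter κ hκc c).op)
    (fun a => ⟨MulOpposite.op (AddMonoidAlgebra.single 0 a.unop), ?_⟩)
    (fun b => ⟨MulOpposite.op (AddMonoidAlgebra.single 0 b.unop), ?_⟩) fun N => ⟨fun h r hr => ?_,
      fun h s hs => ?_⟩
  · exact MulOpposite.unop_injective (evalCenter_single_zero ι hιc 0 _)
  · exact MulOpposite.unop_injective (evalCenter_single_zero κ hκc c _)
  · refine op_smul_eq_zero ι hιc 0 (fun g hg => (hψ g N).1 (h _ ?_))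
      (f := r.unop) (congrArg MulOpposite.unop hr)
    refine congrArg MulOpposite.op ?_
    change evalCenter κ hκc c (AddMonoidAlgebra.mapRingHom _ κ (ψ g)) = 0
    rw [evalCenter_mapRingHom, (hc g).2 hg, map_zero]
  · refine op_smul_eq_zero κ hκc c (fun g hg => ?_)
      (f := s.unop) (congrArg MulOpposite.unop hs)
    obtain ⟨g, rfl⟩ := ψ.surjective g
    refine (hψ g N).2 (h _ ?_)
    refine congrArg MulOpposite.op ?_
    change evalCenter ι hιc 0 (AddMonoidAlgebra.mapRingHom _ ι g) = 0
    rw [evalCenter_mapRingHom, (hc g).1 hg, map_zero]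

end PolyExt

theorem stronglyRetractable_of_jacobson_ne_bot {k Z : Type u} [Field k] [CommRing Z] [Algebra k Z]
    [IsDomain Z] (hJ : Ideal.jacobson (⊥ : Ideal Z) ≠ ⊥) : StronglyRetractable k Z := by
  intro n _ B _ _ φ
  have hcomm (a b : B) : a * b = b * a := by
    have hinj : Function.Injective (PolyExt.C k B n) :=
      fun x y hxy => by simpa [PolyExt.C] using congrArg (fun f => f.coeff 0) hxy
    apply hinj
    apply φ.symm.injective
    simp only [map_mul]
    exact mul_comm (φ.symm (PolyExt.C k B n a)) (φ.symm (PolyExt.C k B n b))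
  let _ : CommRing B := { ‹Ring B› with mul_comm := hcomm }
  let ψ : MvPolynomial (Fin n) Z ≃+* MvPolynomial (Fin n) B := φ.toRingEquiv
  obtain ⟨θ, hθ⟩ := MvPolynomial.exists_ringEquiv_of_jacobson_ne_bot hJ ψ
  have hθ' (z : Z) : φ (PolyExt.C k Z n z) = PolyExt.C k B n (θ z) := hθ z
  ext f
  constructor
  · rintro ⟨_, ⟨z, rfl⟩, rfl⟩
    exact ⟨θ z, (hθ' z).symm⟩
  · rintro ⟨b, rfl⟩
    exact ⟨_, ⟨θ.symm b, rfl⟩, by rw [hθ', θ.apply_symm_apply]⟩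

/-- If the center `Z` of `A` is an integral domain with nonzero
Jacobson radical, then `Z` is strongly retractable, and consequently `A` is strongly
cancellative and strongly Morita cancellative. -/
theorem strongly_cancellative_of_center_domain_nonzero_jacobson
    (k A : Type u) [Field k] [Ring A] [Algebra k A]
    [IsDomain (Subalgebra.center k A)]
    (hJ : Ideal.jacobson (⊥ : Ideal (Subalgebra.center k A)) ≠ ⊥) :
    StronglyRetractable k (Subalgebra.center k A) ∧
      StronglyCancellative k A ∧ StronglyMoritaCancellative k A := by
  have hcenter (B : Type u) [Ring B] [Algebra k B] :
      Set.range ((Subalgebra.center k B).val : Subalgebra.center k B →+* B) = Set.center B :=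
    Subtype.range_coe
  refine ⟨stronglyRetractable_of_jacobson_ne_bot hJ, fun n _ B _ _ ⟨φ⟩ => ?_,
    fun n _ B _ _ h => ?_⟩
  · exact PolyExt.nonempty_algEquiv
      ((Subalgebra.center k A).val : Subalgebra.center k A →+* A)
      ((Subalgebra.center k B).val : Subalgebra.center k B →+* B)
      hJ Subtype.val_injective Subtype.val_injective (hcenter A) (hcenter B) φ
  · exact PolyExt.moritaEquivalent
      ((Subalgebra.center k A).val : Subalgebra.center k A →+* A)
      ((Subalgebra.center k B).val : Subalgebra.center k B →+* B)
      hJ Subtype.val_injective Subtype.val_injective (hcenter A) (hcenter B) h
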